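/- arXiv:1903.03694 — 5 statements merged into one kernel-verified Lean document; each statement's English description precedes it below -/
import Mathlib

section
/- Let C_w = {w ∈ ℝ^d : ‖w‖ ≤ B_w}, let w* be a minimizer of L over C_w with optimal loss L_w* = L(w*), and let v̂ ∈ ℝ^d be a fixed vector satisfying ‖w* − v̂‖ ≤ S for some S > 0. Given n i.i.d. samples (x_1,y_1),…,(x_n,y_n) from D, let ŵ be (a measurable selection of) the minimizer over C_w of the regularized empirical objective (1/n)∑_{i=1}^n ℓ(wᵀx_i, y_i) + (ν/2)‖w − v̂‖², where ν = 8βR²/n + √(64β²R⁴/n² + 16βR²L_w*/(nS²)). Then E[L(ŵ)] − L_w* ≤ 16βR²S²/n + √(16βR²S²L_w*/n), where the expectation is over the n training samples. -/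
open MeasureTheory

/-- Dot product of two vectors in `ℝ^d`. -/
noncomputable def dotp {d : ℕ} (u v : Fin d → ℝ) : ℝ := ∑ i, u i * v i

/-- Euclidean norm of a vector in `ℝ^d`. -/
noncomputable def vnorm {d : ℕ} (u : Fin d → ℝ) : ℝ := Real.sqrt (∑ i, u i ^ 2)

theorem aux_swap {ι Ω : Type*} [Fintype ι] [DecidableEq ι] [MeasurableSpace Ω] (μ : Measure Ω)
    [IsProbabilityMeasure μ] (i : ι) :
    MeasurePreserving (fun p : (ι → Ω) × Ω => (Function.update p.1 i p.2, p.1 i))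
      ((Measure.pi fun _ : ι => μ).prod μ) ((Measure.pi fun _ : ι => μ).prod μ) := by
  have hm : Measurable (fun p : (ι → Ω) × Ω => (Function.update p.1 i p.2, p.1 i)) := by
    refine Measurable.prodMk ?_ (by fun_prop)
    refine measurable_pi_iff.2 fun j => ?_
    by_cases h : j = i
    · subst h; simpa using measurable_snd
    · simp only [Function.update_of_ne h]; fun_prop
  refine ⟨hm, ?_⟩
  symm
  refine Measure.prod_eq_generateFrom generateFrom_pi MeasurableSpace.generateFrom_measurableSet
    isPiSystem_pi MeasurableSpace.isPiSystem_measurableSet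
    (Measure.FiniteSpanningSetsIn.pi fun _ => μ.toFiniteSpanningSetsIn) μ.toFiniteSpanningSetsIn ?_
  rintro _ ⟨s, hs, rfl⟩ t ht
  have hs' : ∀ j, MeasurableSet (s j) := fun j => hs j (Set.mem_univ j)
  have ht' : MeasurableSet t := ht
  rw [Measure.map_apply hm ((MeasurableSet.univ_pi hs').prod ht')]
  have : (fun p : (ι → Ω) × Ω => (Function.update p.1 i p.2, p.1 i)) ⁻¹' (Set.univ.pi s ×ˢ t)
      = (Set.univ.pi (Function.update s i t)) ×ˢ (s i) := by
    ext p
    simp only [Set.mem_preimage, Set.mem_prod, Set.mem_univ_pi]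
    constructor
    · rintro ⟨h1, h2⟩
      refine ⟨fun j => ?_, by simpa using h1 i⟩
      by_cases h : j = i
      · subst h; simpa using h2
      · simpa [h] using h1 j
    · rintro ⟨h1, h2⟩
      refine ⟨fun j => ?_, by simpa using h1 i⟩
      by_cases h : j = i
      · subst h; simpa using h2
      · simpa [h] using h1 j
  rw [this, Measure.prod_prod, Measure.pi_pi, Measure.pi_pi]
  rw [← Finset.mul_prod_erase Finset.univ _ (Finset.mem_univ i),
    ← Finset.mul_prod_erase Finset.univ (fun j => μ (s j)) (Finset.mem_univ i)]
  have : ∏ x ∈ Finset.univ.erase i, μ (Function.update s i t x)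
      = ∏ x ∈ Finset.univ.erase i, μ (s x) := by
    refine Finset.prod_congr rfl fun j hj => ?_
    rw [Function.update_of_ne (Finset.ne_of_mem_erase hj)]
  rw [this, Function.update_self]
  ring

/-- objective -/
noncomputable def auxF {E Ω : Type*} [NormedAddCommGroup E] {n : ℕ} (f : E → Ω → ℝ) (ν : ℝ) (v : E)
    (z : Fin n → Ω) (w : E) : ℝ := (1 / n : ℝ) * ∑ i, f w (z i) + ν / 2 * ‖w - v‖ ^ 2

theorem aux_strong {E Ω : Type*} [NormedAddCommGroup E] [InnerProductSpace ℝ E] {n : ℕ}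
    (f : E → Ω → ℝ) (ν : ℝ) (v : E) (C : Set E)
    (hmid : ∀ u ∈ C, ∀ w ∈ C, (1 / 2 : ℝ) • (u + w) ∈ C)
    (hconv : ∀ ω u w, f ((1 / 2 : ℝ) • (u + w)) ω ≤ (f u ω + f w ω) / 2)
    (z : Fin n → Ω) (u : E) (hu : u ∈ C) (hmin : ∀ w ∈ C, auxF f ν v z u ≤ auxF f ν v z w)
    (w : E) (hw : w ∈ C) :
    auxF f ν v z u + ν / 4 * ‖w - u‖ ^ 2 ≤ auxF f ν v z w := by
  have h1 := hmin _ (hmid u hu w hw)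
  have h2 : ∑ i, f ((1 / 2 : ℝ) • (u + w)) (z i) ≤ (∑ i, f u (z i) + ∑ i, f w (z i)) / 2 := by
    rw [← Finset.sum_add_distrib, Finset.sum_div]
    exact Finset.sum_le_sum fun i _ => hconv _ _ _
  have h3 : (1 / n : ℝ) * ∑ i, f ((1 / 2 : ℝ) • (u + w)) (z i)
      ≤ (1 / n : ℝ) * ((∑ i, f u (z i) + ∑ i, f w (z i)) / 2) :=
    mul_le_mul_of_nonneg_left h2 (by positivity)
  have h4 : ‖(1 / 2 : ℝ) • (u + w) - v‖ ^ 2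
      = (‖u - v‖ ^ 2 + ‖w - v‖ ^ 2) / 2 - ‖w - u‖ ^ 2 / 4 := by
    have e1 : (1 / 2 : ℝ) • (u + w) - v = (1 / 2 : ℝ) • ((u - v) + (w - v)) := by
      module
    have e2 := parallelogram_law_with_norm ℝ (w - v) (u - v)
    have e3 : (w - v) - (u - v) = w - u := by abel
    rw [e3] at e2
    rw [e1, norm_smul, add_comm (u - v), mul_pow]
    norm_num
    nlinarith
  unfold auxF at *
  rw [h4] at h1
  nlinarith

theorem aux_meas {E Ω : Type*} [NormedAddCommGroup E] [InnerProductSpace ℝ E]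
    [MeasurableSpace E] [BorelSpace E] [SecondCountableTopology E] [MeasurableSpace Ω] {n : ℕ}
    (f : E → Ω → ℝ) (ν : ℝ) (hν : 0 < ν) (v : E) (C : Set E)
    (hmid : ∀ u ∈ C, ∀ w ∈ C, (1 / 2 : ℝ) • (u + w) ∈ C)
    (hconv : ∀ ω u w, f ((1 / 2 : ℝ) • (u + w)) ω ≤ (f u ω + f w ω) / 2)
    (hcont : ∀ ω, Continuous fun w => f w ω)
    (hmeas : ∀ w, Measurable (f w))
    (g : (Fin n → Ω) → E) (hg : ∀ z, g z ∈ C)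
    (hmin : ∀ z, ∀ w ∈ C, auxF f ν v z (g z) ≤ auxF f ν v z w) :
    Measurable g := by
  classical
  rcases isEmpty_or_nonempty (Fin n → Ω) with he | ⟨⟨z0⟩⟩
  · exact measurable_of_empty g
  have : Nonempty C := ⟨⟨g z0, hg z0⟩⟩
  let u : ℕ → C := TopologicalSpace.denseSeq C
  have hu : DenseRange u := TopologicalSpace.denseRange_denseSeq C
  have hFm : ∀ w, Measurable fun z => auxF (n := n) f ν v z w := by
    intro w
    unfold auxF
    have := hmeas w
    fun_prop
  have hFc : ∀ z, Continuous fun w => auxF (n := n) f ν v z w := by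
    intro z
    unfold auxF
    have : ∀ i, Continuous fun w => f w (z i) := fun i => hcont _
    fun_prop
  have hbdd : ∀ z, BddBelow (Set.range fun k => auxF f ν v z (u k)) := fun z =>
    ⟨auxF f ν v z (g z), by rintro _ ⟨k, rfl⟩; exact hmin z _ (u k).2⟩
  have hval : ∀ z, ∀ ε > 0, ∃ k, auxF f ν v z (u k) < auxF f ν v z (g z) + ε := by
    intro z ε hε
    have ho : IsOpen {w : C | auxF f ν v z w < auxF f ν v z (g z) + ε} :=
      isOpen_lt ((hFc z).comp continuous_subtype_val) continuous_const
    obtain ⟨k, hk⟩ := hu.exists_mem_open ho ⟨⟨g z, hg z⟩, by simpa using hε⟩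
    exact ⟨k, hk⟩
  have hinf : ∀ z, ⨅ k, auxF f ν v z (u k) = auxF f ν v z (g z) := by
    intro z
    apply le_antisymm
    · refine le_of_forall_pos_le_add fun ε hε => ?_
      obtain ⟨k, hk⟩ := hval z ε hε
      exact (ciInf_le (hbdd z) k).trans hk.le
    · exact le_ciInf fun k => hmin z _ (u k).2
  have hMm : Measurable fun z => auxF f ν v z (g z) := by
    simp_rw [← hinf]
    exact Measurable.iInf fun k => hFm _
  have hp : ∀ m : ℕ, ∀ z, ∃ k, auxF f ν v z (u k) < auxF f ν v z (g z) + 1 / ((m : ℝ) + 1) :=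
    fun m z => hval z _ (by positivity)
  let h : ℕ → (Fin n → Ω) → E := fun m z => u (Nat.find (hp m z))
  have hhm : ∀ m, Measurable (h m) := by
    intro m
    have h1 : Measurable fun z => Nat.find (hp m z) :=
      measurable_find (hp m) fun k => measurableSet_lt (hFm _) (hMm.add_const _)
    exact (measurable_from_nat (f := fun k => (u k : E))).comp h1
  refine measurable_of_tendsto_metrizable hhm (tendsto_pi_nhds.2 fun z => ?_)
  rw [tendsto_iff_norm_sub_tendsto_zero]
  have hb : ∀ m, ‖h m z - g z‖ ≤ Real.sqrt (4 / ν * (1 / ((m : ℝ) + 1))) := by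
    intro m
    apply Real.le_sqrt_of_sq_le
    have h1 := aux_strong f ν v C hmid hconv z (g z) (hg z) (hmin z) (h m z) (u _).2
    have h2 : auxF f ν v z (h m z) < _ := Nat.find_spec (hp m z)
    have h3 : ν / 4 * ‖h m z - g z‖ ^ 2 ≤ 1 / ((m : ℝ) + 1) := by linarith
    calc ‖h m z - g z‖ ^ 2 = 4 / ν * (ν / 4 * ‖h m z - g z‖ ^ 2) := by field_simp
      _ ≤ _ := mul_le_mul_of_nonneg_left h3 (by positivity)
  refine squeeze_zero (fun _ => norm_nonneg _) hb ?_
  have := ((tendsto_one_div_add_atTop_nhds_zero_nat (𝕜 := ℝ)).const_mul (4 / ν)).sqrt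
  simpa using this

theorem aux_stab {p q D K c0 A b c e : ℝ} (hc0 : 0 < c0) (hK : 0 ≤ K) (hp : 0 ≤ p) (hq : 0 ≤ q)
    (hD : 0 ≤ D) (h : c0 * D ^ 2 ≤ A - c + (b - e)) (h1 : A - c ≤ K * p * D)
    (h2 : b - e ≤ K * q * D) :
    A - c ≤ K ^ 2 / c0 * (3 / 2 * p ^ 2 + 1 / 2 * q ^ 2) := by
  have h3 : D ≤ K * (p + q) / c0 := by
    rw [le_div_iff₀ hc0]
    rcases hD.eq_or_lt with h0 | h0
    · rw [← h0]; simp; positivity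
    · nlinarith
  have h4 : K * p * D ≤ K * p * (K * (p + q) / c0) := mul_le_mul_of_nonneg_left h3 (by positivity)
  have h5 : K * p * (K * (p + q) / c0) = K ^ 2 / c0 * (p * (p + q)) := by ring
  have h6 : K ^ 2 / c0 * (p * (p + q)) ≤ K ^ 2 / c0 * (3 / 2 * p ^ 2 + 1 / 2 * q ^ 2) :=
    mul_le_mul_of_nonneg_left (by nlinarith [sq_nonneg (p - q)]) (by positivity)
  linarith

theorem aux_core {E Ω : Type*} [NormedAddCommGroup E] [InnerProductSpace ℝ E]
    [MeasurableSpace E] [BorelSpace E] [SecondCountableTopology E] [MeasurableSpace Ω]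
    (μ : Measure Ω) [IsProbabilityMeasure μ] {n : ℕ} (hn : 0 < n)
    (f : E → Ω → ℝ) (ν : ℝ) (hν : 0 < ν) (v : E) (C : Set E) (K : ℝ) (hK : 0 ≤ K)
    (hmid : ∀ u ∈ C, ∀ w ∈ C, (1 / 2 : ℝ) • (u + w) ∈ C)
    (hf0 : ∀ w ω, 0 ≤ f w ω)
    (hconv : ∀ ω u w, f ((1 / 2 : ℝ) • (u + w)) ω ≤ (f u ω + f w ω) / 2)
    (hlip : ∀ ω u w, f w ω - f u ω ≤ K * Real.sqrt (f w ω) * ‖w - u‖)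
    (hcont : ∀ ω, Continuous fun w => f w ω)
    (hmeas : ∀ w, Measurable (f w))
    (hint : ∀ w, Integrable (f w) μ)
    (g : (Fin n → Ω) → E) (hg : ∀ z, g z ∈ C)
    (hmin : ∀ z, ∀ w ∈ C, auxF f ν v z (g z) ≤ auxF f ν v z w)
    (hgint : Integrable (fun z => ∫ ω, f (g z) ω ∂μ) (Measure.pi fun _ : Fin n => μ))
    (ws : E) (hws : ws ∈ C) :
    (∫ z, (∫ ω, f (g z) ω ∂μ) ∂(Measure.pi fun _ : Fin n => μ)) ≤
      (∫ ω, f ws ω ∂μ) + ν / 2 * ‖ws - v‖ ^ 2 +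
      4 * K ^ 2 / (ν * n) * (∫ z, (∫ ω, f (g z) ω ∂μ) ∂(Measure.pi fun _ : Fin n => μ)) := by
  set P := Measure.pi fun _ : Fin n => μ with hP
  have hn' : (0 : ℝ) < n := by exact_mod_cast hn
  have hgm : Measurable g := aux_meas f ν hν v C hmid hconv hcont hmeas g hg hmin
  have hfm : Measurable (Function.uncurry f) :=
    measurable_uncurry_of_continuous_of_measurable hcont hmeas
  let B : (Fin n → Ω) × Ω → ℝ := fun p => f (g p.1) p.2
  have hBm : Measurable B := hfm.comp ((hgm.comp measurable_fst).prodMk measurable_snd)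
  have hBint : Integrable B (P.prod μ) := by
    rw [integrable_prod_iff hBm.aestronglyMeasurable]
    refine ⟨Filter.Eventually.of_forall fun z => hint (g z), ?_⟩
    simpa [B, abs_of_nonneg (hf0 _ _)] using hgint
  set EL := ∫ z, (∫ ω, f (g z) ω ∂μ) ∂P with hEL
  have hBval : ∫ p, B p ∂(P.prod μ) = EL := integral_prod _ hBint
  let T : Fin n → (Fin n → Ω) × Ω → (Fin n → Ω) × Ω :=
    fun i p => (Function.update p.1 i p.2, p.1 i)
  have hT : ∀ i, MeasurePreserving (T i) (P.prod μ) (P.prod μ) := fun i => aux_swap μ i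
  have hAint : ∀ i, Integrable (fun p => B (T i p)) (P.prod μ) := fun i =>
    (hT i).integrable_comp_of_integrable hBint
  have hAval : ∀ i, ∫ p, B (T i p) ∂(P.prod μ) = EL := by
    intro i
    rw [← hBval]
    conv_rhs => rw [← (hT i).map_eq]
    rw [integral_map (hT i).measurable.aemeasurable hBm.aestronglyMeasurable]
  -- in-sample losses
  have hwsint : ∀ i, Integrable (fun z : Fin n → Ω => f ws (z i)) P := fun i =>
    (measurePreserving_eval (fun _ : Fin n => μ) i).integrable_comp_of_integrable (hint ws)
  have hwsval : ∀ i, ∫ z, f ws (z i) ∂P = ∫ ω, f ws ω ∂μ := by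
    intro i
    have h := measurePreserving_eval (fun _ : Fin n => μ) i
    conv_rhs => rw [← h.map_eq]
    rw [integral_map h.measurable.aemeasurable (hmeas ws).aestronglyMeasurable]
  have herm : ∀ z, (1 / n : ℝ) * ∑ i, f (g z) (z i) ≤
      (1 / n : ℝ) * ∑ i, f ws (z i) + ν / 2 * ‖ws - v‖ ^ 2 := by
    intro z
    have := hmin z ws hws
    unfold auxF at this
    have h2 : 0 ≤ ν / 2 * ‖g z - v‖ ^ 2 := by positivity
    linarith
  have hubint : Integrable (fun z : Fin n → Ω =>
      (1 / n : ℝ) * ∑ i, f ws (z i) + ν / 2 * ‖ws - v‖ ^ 2) P :=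
    ((integrable_finsetSum _ fun i _ => hwsint i).const_mul _).add (integrable_const _)
  have hcint : ∀ i, Integrable (fun z : Fin n → Ω => f (g z) (z i)) P := by
    intro i
    refine (hubint.const_mul (n : ℝ)).mono' ?_ (Filter.Eventually.of_forall fun z => ?_)
    · exact (hfm.comp (hgm.prodMk (measurable_pi_apply i))).aestronglyMeasurable
    · rw [Real.norm_of_nonneg (hf0 _ _)]
      have h1 : f (g z) (z i) ≤ ∑ i, f (g z) (z i) :=
        Finset.single_le_sum (f := fun i => f (g z) (z i)) (fun i _ => hf0 _ _) (Finset.mem_univ i)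
      have h2 := mul_le_mul_of_nonneg_left (herm z) hn'.le
      have h3 : (n : ℝ) * ((1 / n : ℝ) * ∑ i, f (g z) (z i)) = ∑ i, f (g z) (z i) := by
        field_simp
      linarith
  have hstab : ∀ i p, B (T i p) - f (g p.1) (p.1 i) ≤
      K ^ 2 / (ν * n / 2) * (3 / 2 * B (T i p) + 1 / 2 * B p) := by
    rintro i ⟨z, ω⟩
    set z' := Function.update z i ω with hz'
    have hA : B (T i (z, ω)) = f (g z') (z i) := rfl
    have hb : B (z, ω) = f (g z) ω := rfl
    rw [hA, hb]
    have s1 := aux_strong f ν v C hmid hconv z (g z) (hg z) (hmin z) (g z') (hg z')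
    have s2 := aux_strong f ν v C hmid hconv z' (g z') (hg z') (hmin z') (g z) (hg z)
    have hsum : ∀ w, ∑ j, f w (z' j) = ∑ j, f w (z j) - f w (z i) + f w ω := by
      intro w
      rw [← Finset.add_sum_erase Finset.univ (fun j => f w (z' j)) (Finset.mem_univ i),
        ← Finset.add_sum_erase Finset.univ (fun j => f w (z j)) (Finset.mem_univ i)]
      have : ∑ j ∈ Finset.univ.erase i, f w (z' j) = ∑ j ∈ Finset.univ.erase i, f w (z j) :=
        Finset.sum_congr rfl fun j hj => by
          rw [hz', Function.update_of_ne (Finset.ne_of_mem_erase hj)]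
      rw [this]
      simp [hz']
      ring
    unfold auxF at s1 s2
    rw [hsum, hsum, norm_sub_rev (g z) (g z')] at s2
    have key : ν * n / 2 * ‖g z' - g z‖ ^ 2 ≤
        f (g z') (z i) - f (g z) (z i) + (f (g z) ω - f (g z') ω) := by
      have h1 : ν / 2 * ‖g z' - g z‖ ^ 2 ≤ (1 / n : ℝ) *
          (f (g z') (z i) - f (g z) (z i) + (f (g z) ω - f (g z') ω)) := by
        linarith
      have h2 := mul_le_mul_of_nonneg_left h1 hn'.le
      rw [← mul_assoc, ← mul_assoc, mul_one_div_cancel hn'.ne', one_mul] at h2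
      linarith
    have l1 := hlip (z i) (g z) (g z')
    have l2 := hlip ω (g z') (g z)
    rw [norm_sub_rev (g z) (g z')] at l2
    have := aux_stab (c0 := ν * n / 2) (by positivity) hK (Real.sqrt_nonneg _) (Real.sqrt_nonneg _)
      (norm_nonneg _) key l1 l2
    rwa [Real.sq_sqrt (hf0 _ _), Real.sq_sqrt (hf0 _ _)] at this
  have hgap : ∀ i, EL - ∫ z, f (g z) (z i) ∂P ≤ 4 * K ^ 2 / (ν * n) * EL := by
    intro i
    have hc' : Integrable (fun p : (Fin n → Ω) × Ω => f (g p.1) (p.1 i)) (P.prod μ) :=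
      (hcint i).comp_fst μ
    have hcv : ∫ p : (Fin n → Ω) × Ω, f (g p.1) (p.1 i) ∂(P.prod μ) = ∫ z, f (g z) (z i) ∂P := by
      have := integral_fun_fst (μ := P) (ν := μ) (fun z : Fin n → Ω => f (g z) (z i))
      simpa using this
    have h := integral_mono ((hAint i).sub hc')
      ((((hAint i).const_mul (3 / 2)).add (hBint.const_mul (1 / 2))).const_mul
        (K ^ 2 / (ν * n / 2))) (fun p => hstab i p)
    simp only [Pi.sub_apply, Pi.add_apply] at h
    rw [integral_sub (hAint i) hc', hAval, hcv, integral_const_mul,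
      integral_add ((hAint i).const_mul _) (hBint.const_mul _), integral_const_mul,
      integral_const_mul, hAval, hBval] at h
    refine h.trans (le_of_eq ?_)
    field_simp
    ring
  have herm' := integral_mono ((integrable_finsetSum _ fun i _ => hcint i).const_mul (1 / n : ℝ))
    hubint herm
  rw [integral_const_mul, integral_finsetSum _ (fun i _ => hcint i),
    integral_add ((integrable_finsetSum _ fun i _ => hwsint i).const_mul _) (integrable_const _),
    integral_const_mul, integral_finsetSum _ (fun i _ => hwsint i)] at herm'
  simp only [hwsval, Finset.sum_const, Finset.card_univ, Fintype.card_fin, nsmul_eq_mul,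
    integral_const, probReal_univ, one_smul] at herm'
  rw [← mul_assoc, one_div_mul_cancel hn'.ne', one_mul] at herm'
  have hs := Finset.sum_le_sum (s := Finset.univ) fun i _ => hgap i
  rw [Finset.sum_sub_distrib] at hs
  simp only [Finset.sum_const, Finset.card_univ, Fintype.card_fin, nsmul_eq_mul] at hs
  have hs2 := mul_le_mul_of_nonneg_left hs (show (0 : ℝ) ≤ 1 / n by positivity)
  rw [mul_sub, ← mul_assoc, ← mul_assoc, one_div_mul_cancel hn'.ne', one_mul, one_mul] at hs2
  linarith

theorem aux_arith {EL Ls r q S t ν : ℝ} (hr : 0 < r) (hS : 0 < S) (hL : 0 ≤ Ls) (ht0 : 0 ≤ t)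
    (ht : t ≤ S) (hq : 0 ≤ q) (hq2 : q ^ 2 = r ^ 2 + 2 * r * Ls / S ^ 2) (hν : ν = r + q)
    (h : EL ≤ Ls + ν / 2 * t ^ 2 + r / ν * EL) :
    EL - Ls ≤ 2 * r * S ^ 2 + Real.sqrt (2 * r * S ^ 2 * Ls) := by
  have hq2' : S ^ 2 * q ^ 2 = S ^ 2 * r ^ 2 + 2 * r * Ls := by
    rw [hq2]; field_simp
  have hq0 : 0 < q := by
    rcases hq.eq_or_lt with h0 | h0
    · rw [← h0] at hq2'
      have : 0 < S ^ 2 * r ^ 2 := by positivity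
      have : 0 ≤ r * Ls := by positivity
      nlinarith
    · exact h0
  have hν0 : 0 < ν := by linarith
  have ht2 : t ^ 2 ≤ S ^ 2 := by gcongr
  have h1 : EL ≤ Ls + ν / 2 * S ^ 2 + r / ν * EL := by
    have : ν / 2 * t ^ 2 ≤ ν / 2 * S ^ 2 := by gcongr
    linarith
  have h2 := mul_le_mul_of_nonneg_left h1 hν0.le
  have h3 : ν * (Ls + ν / 2 * S ^ 2 + r / ν * EL) = ν * Ls + ν ^ 2 / 2 * S ^ 2 + r * EL := by
    field_simp
  rw [h3] at h2
  have h4 : q * (EL - Ls - ν * S ^ 2) ≤ 0 := by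
    subst hν
    nlinarith
  have h5 : EL - Ls - ν * S ^ 2 ≤ 0 := by
    by_contra hc
    push Not at hc
    have := mul_pos hq0 hc
    linarith
  have h6 : q * S ^ 2 ≤ r * S ^ 2 + Real.sqrt (2 * r * S ^ 2 * Ls) := by
    have hs := Real.sq_sqrt (show 0 ≤ 2 * r * S ^ 2 * Ls by positivity)
    have hs0 := Real.sqrt_nonneg (2 * r * S ^ 2 * Ls)
    refine (pow_le_pow_iff_left₀ (by positivity) (by positivity) two_ne_zero).1 ?_
    have : 0 ≤ r * S ^ 2 * Real.sqrt (2 * r * S ^ 2 * Ls) := by positivity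
    have e : (q * S ^ 2) ^ 2 = S ^ 2 * (S ^ 2 * q ^ 2) := by ring
    rw [e, hq2']
    nlinarith
  subst hν
  linarith

theorem aux_tangent {g : ℝ → ℝ} (hc : ConvexOn ℝ Set.univ g) (hd : Differentiable ℝ g) (a b : ℝ) :
    g a + deriv g a * (b - a) ≤ g b := by
  rcases lt_trichotomy a b with h | h | h
  · have := hc.le_slope_of_hasDerivAt (Set.mem_univ a) (Set.mem_univ b) h (hd a).hasDerivAt
    rw [slope_def_field, le_div_iff₀ (by linarith)] at this
    linarith
  · subst h; simp
  · have := hc.slope_le_of_hasDerivAt (Set.mem_univ b) (Set.mem_univ a) h (hd a).hasDerivAt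
    rw [slope_def_field, div_le_iff₀ (by linarith)] at this
    linarith

theorem aux_self {g : ℝ → ℝ} {β : ℝ} (hβ : 0 < β) (h0 : ∀ a, 0 ≤ g a)
    (hs : ∀ a₁ a₂, g a₁ ≤ g a₂ + deriv g a₂ * (a₁ - a₂) + β / 2 * (a₁ - a₂) ^ 2) (a : ℝ) :
    |deriv g a| ≤ Real.sqrt (2 * β) * Real.sqrt (g a) := by
  rw [← Real.sqrt_mul (by positivity)]
  apply Real.abs_le_sqrt
  have h := (h0 (a - deriv g a / β)).trans (hs (a - deriv g a / β) a)
  have e : g a + deriv g a * (a - deriv g a / β - a) + β / 2 * (a - deriv g a / β - a) ^ 2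
      = g a - deriv g a ^ 2 / (2 * β) := by field_simp; ring
  rw [e] at h
  have : deriv g a ^ 2 / (2 * β) ≤ g a := by linarith
  rw [div_le_iff₀ (by positivity)] at this
  linarith

theorem aux_vnorm {d : ℕ} (w : EuclideanSpace ℝ (Fin d)) : vnorm w.ofLp = ‖w‖ := by
  rw [EuclideanSpace.norm_eq]
  simp [vnorm]

theorem aux_cs {d : ℕ} (u x : Fin d → ℝ) : |dotp u x| ≤ vnorm u * vnorm x := by
  unfold dotp vnorm
  rw [← Real.sqrt_mul (Finset.sum_nonneg fun i _ => sq_nonneg _)]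
  exact Real.abs_le_sqrt (Finset.sum_mul_sq_le_sq_mul_sq _ _ _)

theorem aux_dsub {d : ℕ} (u w x : Fin d → ℝ) : dotp (u - w) x = dotp u x - dotp w x := by
  simp [dotp, sub_mul]

theorem aux_dmid {d : ℕ} (u w x : Fin d → ℝ) :
    dotp ((1 / 2 : ℝ) • (u + w)) x = (1 / 2 : ℝ) * dotp u x + (1 / 2 : ℝ) * dotp w x := by
  simp only [dotp, Finset.mul_sum, ← Finset.sum_add_distrib]
  refine Finset.sum_congr rfl fun i _ => ?_
  simp
  ring

theorem stmt0
    {d n : ℕ} (hn : 0 < n)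
    {Y : Type*} [MeasurableSpace Y]
    {Ωp : Type*} [MeasurableSpace Ωp] (μ : Measure Ωp) [IsProbabilityMeasure μ]
    (X : Ωp → Fin d → ℝ) (lab : Ωp → Y)
    (ℓ : ℝ → Y → ℝ) (β R Bw S : ℝ) (hβ : 0 < β) (hR : 0 < R) (hS : 0 < S)
    (hℓ_nonneg : ∀ a b, 0 ≤ ℓ a b)
    (hℓ_convex : ∀ b, ConvexOn ℝ Set.univ fun a => ℓ a b)
    (hℓ_diff : ∀ b, Differentiable ℝ fun a => ℓ a b)
    (hℓ_smooth : ∀ b a₁ a₂,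
      ℓ a₁ b ≤ ℓ a₂ b + deriv (fun a => ℓ a b) a₂ * (a₁ - a₂) + β / 2 * (a₁ - a₂) ^ 2)
    (hXcov : ∀ i j, ∫ ω, X ω i * X ω j ∂μ = if i = j then (1 : ℝ) else 0)
    (hXbound : ∀ᵐ ω ∂μ, vnorm (X ω) ≤ R)
    (L : (Fin d → ℝ) → ℝ)
    (hL : ∀ w, L w = ∫ ω, ℓ (dotp w (X ω)) (lab ω) ∂μ)
    (hLint : ∀ w : Fin d → ℝ, Integrable (fun ω => ℓ (dotp w (X ω)) (lab ω)) μ)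
    (wstar : Fin d → ℝ) (hws_mem : vnorm wstar ≤ Bw)
    (hws_min : ∀ w, vnorm w ≤ Bw → L wstar ≤ L w)
    (vhat : Fin d → ℝ) (hclose : vnorm (wstar - vhat) ≤ S)
    (ν : ℝ)
    (hν : ν = 8 * β * R ^ 2 / n +
      Real.sqrt (64 * β ^ 2 * R ^ 4 / n ^ 2 + 16 * β * R ^ 2 * L wstar / (n * S ^ 2)))
    (what : (Fin n → Ωp) → (Fin d → ℝ))
    (hwhat_mem : ∀ z, vnorm (what z) ≤ Bw)
    (hwhat_min : ∀ z w, vnorm w ≤ Bw →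
      (1 / n : ℝ) * ∑ i, ℓ (dotp (what z) (X (z i))) (lab (z i)) +
          ν / 2 * vnorm (what z - vhat) ^ 2
        ≤ (1 / n : ℝ) * ∑ i, ℓ (dotp w (X (z i))) (lab (z i)) +
          ν / 2 * vnorm (w - vhat) ^ 2)
    (hwhat_int : Integrable (fun z => L (what z)) (Measure.pi fun _ : Fin n => μ)) :
    (∫ z, L (what z) ∂(Measure.pi fun _ : Fin n => μ)) - L wstar
      ≤ 16 * β * R ^ 2 * S ^ 2 / n +
        Real.sqrt (16 * β * R ^ 2 * S ^ 2 * L wstar / n) := by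
  classical
  let E := EuclideanSpace ℝ (Fin d)
  let f0 : E → Ωp → ℝ := fun w ω => ℓ (dotp w.ofLp (X ω)) (lab ω)
  have hn' : (0 : ℝ) < n := by exact_mod_cast hn
  have hf0c : ∀ ω, Continuous fun w => f0 w ω := by
    intro ω
    have h1 : Continuous fun w : EuclideanSpace ℝ (Fin d) => dotp w.ofLp (X ω) := by
      unfold dotp
      fun_prop
    exact (hℓ_diff (lab ω)).continuous.comp h1
  have hf0int : ∀ w, Integrable (f0 w) μ := fun w => hLint w.ofLp
  let D : ℕ → E := TopologicalSpace.denseSeq E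
  have hD : DenseRange D := TopologicalSpace.denseRange_denseSeq E
  have hmk : ∀ k, ∃ h : Ωp → ℝ, Measurable h ∧ f0 (D k) =ᵐ[μ] h := fun k =>
    (hf0int (D k)).aestronglyMeasurable.aemeasurable
  choose mk hmkm hmke using hmk
  have hae : ∀ᵐ ω ∂μ, vnorm (X ω) ≤ R ∧ ∀ k, f0 (D k) ω = mk k ω :=
    hXbound.and (ae_all_iff.2 hmke)
  let N : Set Ωp := toMeasurable μ {ω | ¬ (vnorm (X ω) ≤ R ∧ ∀ k, f0 (D k) ω = mk k ω)}
  have hNm : MeasurableSet N := measurableSet_toMeasurable _ _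
  have hN0 : μ N = 0 := by
    rw [measure_toMeasurable]
    exact hae
  have hNae : ∀ᵐ ω ∂μ, ω ∉ N := measure_eq_zero_iff_ae_notMem.1 hN0
  have hgood : ∀ ω, ω ∉ N → vnorm (X ω) ≤ R ∧ ∀ k, f0 (D k) ω = mk k ω := by
    intro ω hω
    by_contra hc
    exact hω (subset_toMeasurable μ _ hc)
  obtain ⟨ω0, hω0⟩ := hNae.exists
  let φ : Ωp → Ωp := fun ω => if ω ∈ N then ω0 else ω
  have hφN : ∀ ω, φ ω ∉ N := by
    intro ω
    by_cases h : ω ∈ N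
    · simpa [φ, h] using hω0
    · simp [φ, h]
  have hφae : ∀ᵐ ω ∂μ, φ ω = ω := by
    filter_upwards [hNae] with ω h
    simp [φ, h]
  let f : E → Ωp → ℝ := fun w ω => f0 w (φ ω)
  have hfc : ∀ ω, Continuous fun w => f w ω := fun ω => hf0c (φ ω)
  have hfae : ∀ w, f w =ᵐ[μ] f0 w := by
    intro w
    filter_upwards [hφae] with ω h
    simp [f, h]
  have hfmD : ∀ k, Measurable (f (D k)) := by
    intro k
    have : f (D k) = fun ω => if ω ∈ N then mk k ω0 else mk k ω := by
      funext ω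
      have h1 := (hgood _ (hφN ω)).2 k
      simp only [f, h1]
      by_cases h : ω ∈ N <;> simp [φ, h]
    rw [this]
    exact Measurable.ite hNm measurable_const (hmkm k)
  have hfm : ∀ w, Measurable (f w) := by
    intro w
    obtain ⟨x, hx, hxl⟩ := mem_closure_iff_seq_limit.1 (hD w)
    refine measurable_of_tendsto_metrizable (f := fun m => f (x m)) (fun m => ?_)
      (tendsto_pi_nhds.2 fun ω => ((hfc ω).tendsto w).comp hxl)
    obtain ⟨k, hk⟩ := hx m
    rw [← hk]
    exact hfmD k
  have hfL : ∀ w : E, ∫ ω, f w ω ∂μ = L w.ofLp := by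
    intro w
    rw [hL, integral_congr_ae (hfae w)]
  have hLs0 : 0 ≤ L wstar := by
    rw [hL]
    exact integral_nonneg fun ω => hℓ_nonneg _ _
  set q := Real.sqrt (64 * β ^ 2 * R ^ 4 / n ^ 2 + 16 * β * R ^ 2 * L wstar / (n * S ^ 2)) with hq
  have hr : 0 < 8 * β * R ^ 2 / n := by positivity
  have hq0 : 0 ≤ q := Real.sqrt_nonneg _
  have hν0 : 0 < ν := by rw [hν]; linarith
  let C : Set E := {w | ‖w‖ ≤ Bw}
  let g : (Fin n → Ωp) → E := fun z => WithLp.toLp 2 (what fun i => φ (z i))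
  have hgae : ∀ᵐ z ∂(Measure.pi fun _ : Fin n => μ), L (what z) = ∫ ω, f (g z) ω ∂μ := by
    have : ∀ i, ∀ᵐ z ∂(Measure.pi fun _ : Fin n => μ), φ (z i) = z i := fun i =>
      (measurePreserving_eval (fun _ : Fin n => μ) i).quasiMeasurePreserving.ae hφae
    filter_upwards [ae_all_iff.2 this] with z hz
    rw [hfL]
    simp only [g, hz]
  have hmain := aux_core μ hn f ν hν0 (WithLp.toLp 2 vhat) C (Real.sqrt (2 * β) * R) (by positivity)
    (by
      intro u hu w hw
      have hu' : ‖u‖ ≤ Bw := hu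
      have hw' : ‖w‖ ≤ Bw := hw
      change ‖(1 / 2 : ℝ) • (u + w)‖ ≤ Bw
      rw [norm_smul]
      have := norm_add_le u w
      norm_num
      linarith)
    (fun w ω => hℓ_nonneg _ _)
    (by
      intro ω u w
      have := (hℓ_convex (lab (φ ω))).2 (Set.mem_univ (dotp u.ofLp (X (φ ω))))
        (Set.mem_univ (dotp w.ofLp (X (φ ω)))) (show (0 : ℝ) ≤ 1 / 2 by norm_num)
        (show (0 : ℝ) ≤ 1 / 2 by norm_num) (by norm_num)
      simp only [smul_eq_mul] at this
      change ℓ (dotp ((1 / 2 : ℝ) • (u.ofLp + w.ofLp)) _) _ ≤ (ℓ _ _ + ℓ _ _) / 2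
      rw [aux_dmid]
      linarith)
    (by
      intro ω u w
      have hx := (hgood _ (hφN ω)).1
      set x := X (φ ω)
      set b := lab (φ ω)
      change ℓ (dotp w.ofLp x) b - ℓ (dotp u.ofLp x) b ≤
        Real.sqrt (2 * β) * R * Real.sqrt (ℓ (dotp w.ofLp x) b) * ‖w - u‖
      have h1 := aux_tangent (hℓ_convex b) (hℓ_diff b) (dotp w.ofLp x) (dotp u.ofLp x)
      have h2 := aux_self hβ (fun a => hℓ_nonneg a b) (hℓ_smooth b) (dotp w.ofLp x)
      have h3 : |dotp (w - u).ofLp x| ≤ ‖w - u‖ * R := by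
        refine (aux_cs _ _).trans ?_
        rw [aux_vnorm]
        gcongr
      have h4 : dotp (w - u).ofLp x = dotp w.ofLp x - dotp u.ofLp x := aux_dsub _ _ _
      have h5 : deriv (fun a => ℓ a b) (dotp w.ofLp x) * dotp (w - u).ofLp x ≤
          (Real.sqrt (2 * β) * Real.sqrt (ℓ (dotp w.ofLp x) b)) * (‖w - u‖ * R) := by
        refine (le_abs_self _).trans ?_
        rw [abs_mul]
        gcongr
      rw [h4] at h5
      linarith)
    hfc hfm (fun w => (hf0int w).congr (hfae w).symm) g
    (fun z => by
      change ‖_‖ ≤ Bw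
      rw [← aux_vnorm]
      exact hwhat_mem _)
    (by
      intro z w hw
      have hw' : vnorm w.ofLp ≤ Bw := by rw [aux_vnorm]; exact hw
      have := hwhat_min (fun i => φ (z i)) w.ofLp hw'
      unfold auxF
      rw [← aux_vnorm, ← aux_vnorm]
      exact this)
    (hwhat_int.congr hgae) (WithLp.toLp 2 wstar)
    (by
      change ‖_‖ ≤ Bw
      rw [← aux_vnorm]
      exact hws_mem)
  rw [← integral_congr_ae hgae, hfL, ← aux_vnorm] at hmain
  have hcoef : 4 * (Real.sqrt (2 * β) * R) ^ 2 / (ν * n) = 8 * β * R ^ 2 / n / ν := by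
    rw [mul_pow, Real.sq_sqrt (by positivity)]
    field_simp
    ring
  rw [hcoef] at hmain
  have hfin := aux_arith hr hS hLs0 (Real.sqrt_nonneg _) hclose hq0
    (by
      rw [hq, Real.sq_sqrt (by positivity)]
      field_simp
      ring) hν hmain
  have e1 : 2 * (8 * β * R ^ 2 / n) * S ^ 2 = 16 * β * R ^ 2 * S ^ 2 / n := by ring
  have e2 : 16 * β * R ^ 2 * S ^ 2 / n * L wstar = 16 * β * R ^ 2 * S ^ 2 * L wstar / n := by ring
  rw [e1, e2] at hfin
  exact hfin
end

section
/- Suppose additionally that for every b ∈ Y the map a ↦ ℓ(a,b) is σ-strongly convex. Let C_w = {w : ‖w‖ ≤ B_w} ⊆ C_v = {v : ‖v‖ ≤ B_v} with B_w ≤ B_v, let w* minimize L over C_w with L_w* = L(w*), let v* minimize L over C_v with L_v* = L(v*), and let v̂ be a random vector (e.g., a learned teacher) taking values in C_v, with excess risk ε_t = E[L(v̂)] − L_v*. Then E[(w*ᵀx − v̂ᵀx)²] ≤ 4(L_w* − L_v* + ε_t)/σ, where the expectation is over both the data distribution and the randomness of v̂. -/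
open MeasureTheory
open scoped RealInnerProductSpace

theorem stmt4
    {d : ℕ} {Y : Type*} [MeasurableSpace Y]
    {Ωp : Type*} [MeasurableSpace Ωp] (μ : Measure Ωp) [IsProbabilityMeasure μ]
    {Θ : Type*} [MeasurableSpace Θ] (ρ : Measure Θ) [IsProbabilityMeasure ρ]
    (X : Ωp → EuclideanSpace ℝ (Fin d)) (lab : Ωp → Y)
    (ℓ : ℝ → Y → ℝ) (σ : ℝ) (hσ : 0 < σ)
    (hℓ_nonneg : ∀ a b, 0 ≤ ℓ a b)
    (hℓ_diff : ∀ b, Differentiable ℝ fun a => ℓ a b)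
    (hℓ_sc : ∀ b a₁ a₂,
      ℓ a₂ b + deriv (fun a => ℓ a b) a₂ * (a₁ - a₂) + σ / 2 * (a₁ - a₂) ^ 2 ≤ ℓ a₁ b)
    (L : EuclideanSpace ℝ (Fin d) → ℝ)
    (hL : ∀ w, L w = ∫ ω, ℓ (⟪w, X ω⟫) (lab ω) ∂μ)
    (hLint : ∀ w : EuclideanSpace ℝ (Fin d),
      Integrable (fun ω => ℓ (⟪w, X ω⟫) (lab ω)) μ)
    -- the gradient of L is obtained by differentiating under the integral
    (gradL : EuclideanSpace ℝ (Fin d) → EuclideanSpace ℝ (Fin d))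
    (hgradL : ∀ w, gradL w =
      fun j => ∫ ω, deriv (fun a => ℓ a (lab ω)) (⟪w, X ω⟫) * X ω j ∂μ)
    (hgrad : ∀ w, HasGradientAt L (gradL w) w)
    -- nested hypothesis classes and their minimizers
    (Bw Bv : ℝ) (hBwv : Bw ≤ Bv)
    (wstar : EuclideanSpace ℝ (Fin d)) (hws_mem : ‖wstar‖ ≤ Bw)
    (hws_min : ∀ w : EuclideanSpace ℝ (Fin d), ‖w‖ ≤ Bw → L wstar ≤ L w)
    (vstar : EuclideanSpace ℝ (Fin d)) (hvs_mem : ‖vstar‖ ≤ Bv)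
    (hvs_min : ∀ v : EuclideanSpace ℝ (Fin d), ‖v‖ ≤ Bv → L vstar ≤ L v)
    -- the (random) teacher predictor and its excess risk
    (vhat : Θ → EuclideanSpace ℝ (Fin d))
    (hvhat_mem : ∀ θ, ‖vhat θ‖ ≤ Bv)
    (hvhat_int : Integrable (fun θ => L (vhat θ)) ρ)
    (εt : ℝ) (hεt : εt = (∫ θ, L (vhat θ) ∂ρ) - L vstar)
    -- integrability of the squared prediction discrepancies
    (hsqint : ∀ θ, Integrable (fun ω => (⟪wstar, X ω⟫ - ⟪vhat θ, X ω⟫) ^ 2) μ)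
    (hsqint' : Integrable
      (fun θ => ∫ ω, (⟪wstar, X ω⟫ - ⟪vhat θ, X ω⟫) ^ 2 ∂μ) ρ) :
    (∫ θ, ∫ ω, (⟪wstar, X ω⟫ - ⟪vhat θ, X ω⟫) ^ 2 ∂μ ∂ρ)
      ≤ 4 * (L wstar - L vstar + εt) / σ := by
  have key : ∀ θ, ∫ ω, (⟪wstar, X ω⟫ - ⟪vhat θ, X ω⟫) ^ 2 ∂μ
      ≤ 4 / σ * (L wstar + L (vhat θ) - 2 * L vstar) := by
    intro θ
    have hmem : ‖(1 / 2 : ℝ) • (wstar + vhat θ)‖ ≤ Bv := by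
      rw [norm_smul]
      have h1 := norm_add_le wstar (vhat θ)
      have h2 := hvhat_mem θ
      norm_num
      linarith
    have hmin := hvs_min _ hmem
    have hint : ∫ ω, (2 * ℓ (⟪(1 / 2 : ℝ) • (wstar + vhat θ), X ω⟫) (lab ω)
          + σ / 4 * (⟪wstar, X ω⟫ - ⟪vhat θ, X ω⟫) ^ 2) ∂μ
        ≤ ∫ ω, (ℓ (⟪wstar, X ω⟫) (lab ω) + ℓ (⟪vhat θ, X ω⟫) (lab ω)) ∂μ := by
      refine integral_mono (((hLint _).const_mul 2).add ((hsqint θ).const_mul _))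
        ((hLint _).add (hLint _)) ?_
      intro ω
      have e : ⟪(1 / 2 : ℝ) • (wstar + vhat θ), X ω⟫
          = (⟪wstar, X ω⟫ + ⟪vhat θ, X ω⟫) / 2 := by
        rw [real_inner_smul_left, inner_add_left]; ring
      simp only [e]
      have h1 := hℓ_sc (lab ω) ⟪wstar, X ω⟫ ((⟪wstar, X ω⟫ + ⟪vhat θ, X ω⟫) / 2)
      have h2 := hℓ_sc (lab ω) ⟪vhat θ, X ω⟫ ((⟪wstar, X ω⟫ + ⟪vhat θ, X ω⟫) / 2)
      linarith
    rw [integral_add ((hLint _).const_mul 2) ((hsqint θ).const_mul _),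
      integral_add (hLint _) (hLint _), integral_const_mul, integral_const_mul,
      ← hL, ← hL, ← hL] at hint
    rw [div_mul_eq_mul_div, le_div_iff₀ hσ]
    linarith
  have hj : Integrable (fun θ => L wstar + L (vhat θ)) ρ := (integrable_const _).add hvhat_int
  have hi : Integrable (fun θ => L wstar + L (vhat θ) - 2 * L vstar) ρ :=
    ((integrable_const _).add hvhat_int).sub (integrable_const _)
  refine (integral_mono hsqint' (hi.const_mul (4 / σ)) key).trans (le_of_eq ?_)
  rw [integral_const_mul, integral_sub hj (integrable_const _),
    integral_add (integrable_const _) hvhat_int, hεt]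
  simp only [integral_const, probReal_univ, smul_eq_mul]
  ring
end

section
/- Under the CCA setup, for any w ∈ ℝ^{d_x} and v ∈ ℝ^{d_z}, writing w̃ = Ũᵀw and ṽ = Ṽᵀv (with the conventions λ_i = 0 for i beyond the rank of E[xzᵀ] and ṽ^i = 0 for i > d_z): E[(wᵀx − vᵀz)²] = ∑_{i=1}^{d_x} (1−λ_i)(w̃^i)² + ∑_{i=1}^{r} λ_i (w̃^i − ṽ^i)² + ∑_{i=1}^{d_z} (1−λ_i)(ṽ^i)², where r = rank(E[xzᵀ]), and also E[(wᵀx − vᵀz)²] = ∑_{i=1}^{d_x} (w̃^i − λ_i ṽ^i)² + ∑_{i=1}^{d_z} (1−λ_i²)(ṽ^i)². -/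
open MeasureTheory

/-- The rectangular diagonal matrix of canonical correlations. -/
noncomputable def sigMat (dx dz : ℕ) (lam : ℕ → ℝ) : Matrix (Fin dx) (Fin dz) ℝ :=
  Matrix.of fun i j => if (i : ℕ) = (j : ℕ) then lam (i : ℕ) else 0

theorem aux_cross {dx dz : ℕ} (lam wt vt : ℕ → ℝ) (r : ℕ) (hrx : r ≤ dx) (hrz : r ≤ dz)
    (hl : ∀ i, r ≤ i → lam i = 0) :
    ∑ i : Fin dx, ∑ j : Fin dz, wt i * sigMat dx dz lam i j * vt j
      = ∑ i ∈ Finset.range r, lam i * (wt i * vt i) := by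
  have h1 : ∀ i : Fin dx, ∑ j : Fin dz, wt i * sigMat dx dz lam i j * vt j
      = lam i * (wt i * vt i) := by
    intro i
    simp only [sigMat, Matrix.of_apply]
    rw [Fin.sum_univ_eq_sum_range
      (fun j => wt i * (if (i : ℕ) = j then lam (i : ℕ) else 0) * vt j) dz]
    by_cases hi : (i : ℕ) < dz
    · rw [Finset.sum_eq_single (i : ℕ)]
      · simp; ring
      · intro b _ hb
        simp [hb.symm]
      · intro h; simp at h; omega
    · rw [hl i (by omega)]
      simp
  simp_rw [h1]
  rw [Fin.sum_univ_eq_sum_range (fun i => lam i * (wt i * vt i)) dx]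
  symm
  apply Finset.sum_subset (by simpa using hrx)
  intro i _ hi
  rw [hl i (by simpa using hi)]; simp

theorem aux_norm {d : ℕ} (U : Matrix (Fin d) (Fin d) ℝ) (hU : U.transpose * U = 1)
    (w : Fin d → ℝ) (wt : ℕ → ℝ)
    (hwt : ∀ i : ℕ, wt i = if h : i < d then U.transpose.mulVec w ⟨i, h⟩ else 0) :
    ∑ i, w i ^ 2 = ∑ i ∈ Finset.range d, wt i ^ 2 := by
  rw [← Fin.sum_univ_eq_sum_range (fun i => wt i ^ 2) d]
  have h : ∀ i : Fin d, wt i = U.transpose.mulVec w i := by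
    intro i; rw [hwt]; simp
  simp_rw [h]
  have h2 : U * U.transpose = 1 := mul_eq_one_comm.mp hU
  have h3 : (U.transpose.mulVec w) ⬝ᵥ (U.transpose.mulVec w) = w ⬝ᵥ w := by
    rw [Matrix.dotProduct_mulVec, Matrix.vecMul_transpose, Matrix.mulVec_mulVec, h2,
      Matrix.one_mulVec]
  simp only [dotProduct] at h3
  simp_rw [pow_two]
  exact h3.symm

open Matrix in
theorem aux_bil {dx dz : ℕ} (U : Matrix (Fin dx) (Fin dx) ℝ) (V : Matrix (Fin dz) (Fin dz) ℝ)
    (S : Matrix (Fin dx) (Fin dz) ℝ) (w : Fin dx → ℝ) (v : Fin dz → ℝ) (wt vt : ℕ → ℝ)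
    (hwt : ∀ i : ℕ, wt i = if h : i < dx then U.transpose.mulVec w ⟨i, h⟩ else 0)
    (hvt : ∀ i : ℕ, vt i = if h : i < dz then V.transpose.mulVec v ⟨i, h⟩ else 0) :
    ∑ i, ∑ j, w i * v j * (U * S * V.transpose) i j
      = ∑ i : Fin dx, ∑ j : Fin dz, wt i * S i j * vt j := by
  have hw : ∀ i : Fin dx, wt i = U.transpose.mulVec w i := by
    intro i; rw [hwt]; simp
  have hv : ∀ i : Fin dz, vt i = V.transpose.mulVec v i := by
    intro i; rw [hvt]; simp
  have key : w ⬝ᵥ ((U * S * V.transpose) *ᵥ v)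
      = (U.transpose *ᵥ w) ⬝ᵥ (S *ᵥ (V.transpose *ᵥ v)) := by
    rw [Matrix.mulVec_transpose U, ← Matrix.dotProduct_mulVec, Matrix.mulVec_mulVec,
      Matrix.mulVec_mulVec, Matrix.mul_assoc]
  have e : ∀ (a : Fin dx → ℝ) (M : Matrix (Fin dx) (Fin dz) ℝ) (b : Fin dz → ℝ),
      a ⬝ᵥ (M *ᵥ b) = ∑ i, ∑ j, a i * M i j * b j := by
    intro a M b
    simp only [dotProduct, Matrix.mulVec, Finset.mul_sum, mul_assoc]
  rw [e, e] at key
  simp_rw [hw, hv, ← key]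
  refine Finset.sum_congr rfl fun i _ => Finset.sum_congr rfl fun j _ => by ring

theorem aux_int {Ωp : Type*} [MeasurableSpace Ωp] (μ : Measure Ωp) {m n : ℕ}
    (X : Ωp → Fin m → ℝ) (Z : Ωp → Fin n → ℝ) (w : Fin m → ℝ) (v : Fin n → ℝ)
    (h : ∀ i j, Integrable (fun ω => X ω i * Z ω j) μ) :
    Integrable (fun ω => dotp w (X ω) * dotp v (Z ω)) μ ∧
    ∫ ω, dotp w (X ω) * dotp v (Z ω) ∂μ = ∑ i, ∑ j, w i * v j * ∫ ω, X ω i * Z ω j ∂μ := by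
  have e : (fun ω => dotp w (X ω) * dotp v (Z ω))
      = fun ω => ∑ i, ∑ j, w i * v j * (X ω i * Z ω j) := by
    funext ω
    simp only [dotp, Finset.sum_mul_sum]
    refine Finset.sum_congr rfl fun i _ => Finset.sum_congr rfl fun j _ => by ring
  have hi : ∀ i j, Integrable (fun ω => w i * v j * (X ω i * Z ω j)) μ :=
    fun i j => (h i j).const_mul _
  rw [e]
  refine ⟨integrable_finsetSum _ fun i _ => integrable_finsetSum _ fun j _ => hi i j, ?_⟩
  rw [integral_finsetSum _ fun i _ => integrable_finsetSum _ fun j _ => hi i j]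
  refine Finset.sum_congr rfl fun i _ => ?_
  rw [integral_finsetSum _ fun j _ => hi i j]
  refine Finset.sum_congr rfl fun j _ => ?_
  rw [integral_const_mul]

theorem stmt6
    {dx dz : ℕ}
    {Ωp : Type*} [MeasurableSpace Ωp] (μ : Measure Ωp) [IsProbabilityMeasure μ]
    (X : Ωp → Fin dx → ℝ) (Z : Ωp → Fin dz → ℝ)
    -- CCA setup
    (U : Matrix (Fin dx) (Fin dx) ℝ) (V : Matrix (Fin dz) (Fin dz) ℝ) (lam : ℕ → ℝ)
    (hU : U.transpose * U = 1) (hV : V.transpose * V = 1)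
    (hlam_le_one : lam 0 ≤ 1) (hlam_nonneg : ∀ i, 0 ≤ lam i)
    (hlam_mono : ∀ i j, i ≤ j → lam j ≤ lam i)
    (hXmean : ∀ i, ∫ ω, X ω i ∂μ = 0) (hZmean : ∀ j, ∫ ω, Z ω j ∂μ = 0)
    (hXcov : ∀ i j, ∫ ω, X ω i * X ω j ∂μ = if i = j then (1 : ℝ) else 0)
    (hZcov : ∀ i j, ∫ ω, Z ω i * Z ω j ∂μ = if i = j then (1 : ℝ) else 0)
    (hXZcov : ∀ i j, ∫ ω, X ω i * Z ω j ∂μ = (U * sigMat dx dz lam * V.transpose) i j)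
    -- integrability of the second moments
    (hIntxx : ∀ i j, Integrable (fun ω => X ω i * X ω j) μ)
    (hIntzz : ∀ i j, Integrable (fun ω => Z ω i * Z ω j) μ)
    (hIntxz : ∀ i j, Integrable (fun ω => X ω i * Z ω j) μ)
    -- the rank of the cross-covariance matrix; `lam` vanishes beyond the rank
    (r : ℕ)
    (hr : r = (Matrix.of fun i j => ∫ ω, X ω i * Z ω j ∂μ :
      Matrix (Fin dx) (Fin dz) ℝ).rank)
    (hlam_rank : ∀ i, r ≤ i → lam i = 0)
    -- the predictors and their CCA coordinates (padded with zeros)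
    (w : Fin dx → ℝ) (v : Fin dz → ℝ) (wt vt : ℕ → ℝ)
    (hwt : ∀ i : ℕ, wt i = if h : i < dx then U.transpose.mulVec w ⟨i, h⟩ else 0)
    (hvt : ∀ i : ℕ, vt i = if h : i < dz then V.transpose.mulVec v ⟨i, h⟩ else 0) :
    (∫ ω, (dotp w (X ω) - dotp v (Z ω)) ^ 2 ∂μ
        = ∑ i ∈ Finset.range dx, (1 - lam i) * wt i ^ 2
          + ∑ i ∈ Finset.range r, lam i * (wt i - vt i) ^ 2
          + ∑ i ∈ Finset.range dz, (1 - lam i) * vt i ^ 2) ∧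
    (∫ ω, (dotp w (X ω) - dotp v (Z ω)) ^ 2 ∂μ
        = ∑ i ∈ Finset.range dx, (wt i - lam i * vt i) ^ 2
          + ∑ i ∈ Finset.range dz, (1 - lam i ^ 2) * vt i ^ 2) := by
  have hrx : r ≤ dx := by
    rw [hr]; simpa using Matrix.rank_le_card_height
      (Matrix.of fun i j => ∫ ω, X ω i * Z ω j ∂μ : Matrix (Fin dx) (Fin dz) ℝ)
  have hrz : r ≤ dz := by
    rw [hr]; simpa using Matrix.rank_le_card_width
      (Matrix.of fun i j => ∫ ω, X ω i * Z ω j ∂μ : Matrix (Fin dx) (Fin dz) ℝ)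
  obtain ⟨ix, ex⟩ := aux_int μ X X w w hIntxx
  obtain ⟨iz, ez⟩ := aux_int μ Z Z v v hIntzz
  obtain ⟨ic, ec⟩ := aux_int μ X Z w v hIntxz
  have E : ∫ ω, (dotp w (X ω) - dotp v (Z ω)) ^ 2 ∂μ
      = ∑ i ∈ Finset.range dx, wt i ^ 2 + ∑ i ∈ Finset.range dz, vt i ^ 2
        - 2 * ∑ i ∈ Finset.range r, lam i * (wt i * vt i) := by
    have e : (fun ω => (dotp w (X ω) - dotp v (Z ω)) ^ 2)
        = fun ω => dotp w (X ω) * dotp w (X ω) + dotp v (Z ω) * dotp v (Z ω)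
          - 2 * (dotp w (X ω) * dotp v (Z ω)) := by
      funext ω; ring
    have ixz : Integrable (fun ω => dotp w (X ω) * dotp w (X ω)
        + dotp v (Z ω) * dotp v (Z ω)) μ := ix.add iz
    rw [e, integral_sub ixz (ic.const_mul 2), integral_add ix iz, integral_const_mul,
      ex, ez, ec]
    simp_rw [hXcov, hZcov, hXZcov]
    rw [aux_bil U V _ w v wt vt hwt hvt, aux_cross lam wt vt r hrx hrz hlam_rank,
      ← aux_norm U hU w wt hwt, ← aux_norm V hV v vt hvt]
    simp [pow_two]
  have R : ∀ (n : ℕ) (f : ℕ → ℝ), r ≤ n → (∀ i, r ≤ i → f i = 0) →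
      ∑ i ∈ Finset.range n, f i = ∑ i ∈ Finset.range r, f i := by
    intro n f hn hf
    symm
    apply Finset.sum_subset (by simpa using hn)
    intro i _ hi
    exact hf i (by simpa using hi)
  rw [E]
  constructor
  · have a1 := R dx (fun i => lam i * wt i ^ 2) hrx fun i hi => by simp [hlam_rank i hi]
    have a2 := R dz (fun i => lam i * vt i ^ 2) hrz fun i hi => by simp [hlam_rank i hi]
    have a3 : ∑ i ∈ Finset.range r, lam i * (wt i - vt i) ^ 2
        = ∑ i ∈ Finset.range r, lam i * wt i ^ 2 + ∑ i ∈ Finset.range r, lam i * vt i ^ 2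
          - 2 * ∑ i ∈ Finset.range r, lam i * (wt i * vt i) := by
      rw [Finset.mul_sum, ← Finset.sum_add_distrib, ← Finset.sum_sub_distrib]
      exact Finset.sum_congr rfl fun i _ => by ring
    simp only [sub_mul, one_mul, Finset.sum_sub_distrib]
    rw [a3]
    linarith
  · have a1 := R dx (fun i => lam i ^ 2 * vt i ^ 2) hrx fun i hi => by simp [hlam_rank i hi]
    have a2 := R dz (fun i => lam i ^ 2 * vt i ^ 2) hrz fun i hi => by simp [hlam_rank i hi]
    have a4 := R dx (fun i => lam i * (wt i * vt i)) hrx fun i hi => by simp [hlam_rank i hi]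
    have a3 : ∑ i ∈ Finset.range dx, (wt i - lam i * vt i) ^ 2
        = ∑ i ∈ Finset.range dx, wt i ^ 2 + ∑ i ∈ Finset.range dx, lam i ^ 2 * vt i ^ 2
          - 2 * ∑ i ∈ Finset.range dx, lam i * (wt i * vt i) := by
      rw [Finset.mul_sum, ← Finset.sum_add_distrib, ← Finset.sum_sub_distrib]
      exact Finset.sum_congr rfl fun i _ => by ring
    rw [a3]
    simp only [sub_mul, one_mul, Finset.sum_sub_distrib]
    linarith
end

section
/- Let γ > 0, ν ≥ 0, 0 ≤ λ₁ ≤ 1, and let Σ ∈ ℝ^{d_x × d_z} be rectangular diagonal with all diagonal entries in [0, λ₁]. Define the block matrix M = [[(γ+ν)I_{d_x}, −νΣ],[−νΣᵀ, (γ+ν)I_{d_z}]]. Then M is positive definite (hence invertible), the top-left d_x × d_x block of M⁻¹ equals ((γ+ν)I_{d_x} − (ν²/(γ+ν))ΣΣᵀ)⁻¹, and its operator norm satisfies ‖(M⁻¹)_{xx}‖ ≤ (γ+ν)/((γ+ν)² − λ₁²ν²). -/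
theorem aux_mul {dx dz : ℕ} (Sm : Matrix (Fin dx) (Fin dz) ℝ)
    (hdiag : ∀ (i : Fin dx) (j : Fin dz), (i : ℕ) ≠ (j : ℕ) → Sm i j = 0) :
    Sm * Sm.transpose = Matrix.diagonal (fun i => ∑ j, Sm i j ^ 2) := by
  ext i k
  rw [Matrix.mul_apply, Matrix.diagonal_apply]
  split_ifs with h
  · subst h
    simp [Matrix.transpose_apply, sq]
  · apply Finset.sum_eq_zero
    intro j _
    rw [Matrix.transpose_apply]
    by_cases h1 : (i : ℕ) = j
    · rw [hdiag k j (fun h2 => h (Fin.ext (h1.trans h2.symm))), mul_zero]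
    · rw [hdiag i j h1, zero_mul]

theorem aux_le {dx dz : ℕ} (l : ℝ) (hl : 0 ≤ l) (Sm : Matrix (Fin dx) (Fin dz) ℝ)
    (hdiag : ∀ (i : Fin dx) (j : Fin dz), (i : ℕ) ≠ (j : ℕ) → Sm i j = 0)
    (hentries : ∀ (i : Fin dx) (j : Fin dz), 0 ≤ Sm i j ∧ Sm i j ≤ l) (i : Fin dx) :
    ∑ j, Sm i j ^ 2 ≤ l ^ 2 := by
  by_cases h : (i : ℕ) < dz
  · rw [Finset.sum_eq_single (⟨i, h⟩ : Fin dz)]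
    · exact pow_le_pow_left₀ (hentries _ _).1 (hentries _ _).2 2
    · intro j _ hj
      rw [hdiag i j (fun h2 => hj (Fin.ext h2.symm))]; simp
    · simp
  · rw [Finset.sum_eq_zero]
    · positivity
    · intro j _
      rw [hdiag i j (fun h2 => h (h2 ▸ j.2))]; simp

theorem stmt12
    {dx dz : ℕ} (γ ν lam1 : ℝ) (hγ : 0 < γ) (hν : 0 ≤ ν)
    (hlam1_nonneg : 0 ≤ lam1) (hlam1_le_one : lam1 ≤ 1)
    (Sm : Matrix (Fin dx) (Fin dz) ℝ)
    (hdiag : ∀ (i : Fin dx) (j : Fin dz), (i : ℕ) ≠ (j : ℕ) → Sm i j = 0)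
    (hentries : ∀ (i : Fin dx) (j : Fin dz), 0 ≤ Sm i j ∧ Sm i j ≤ lam1)
    (M : Matrix (Fin dx ⊕ Fin dz) (Fin dx ⊕ Fin dz) ℝ)
    (hM : M = Matrix.fromBlocks
      ((γ + ν) • (1 : Matrix (Fin dx) (Fin dx) ℝ)) (-(ν • Sm))
      (-(ν • Sm.transpose)) ((γ + ν) • (1 : Matrix (Fin dz) (Fin dz) ℝ))) :
    M.PosDef ∧ IsUnit M ∧
    M⁻¹.toBlocks₁₁ =
      ((γ + ν) • (1 : Matrix (Fin dx) (Fin dx) ℝ) -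
        (ν ^ 2 / (γ + ν)) • (Sm * Sm.transpose))⁻¹ ∧
    ‖Matrix.toEuclideanCLM (𝕜 := ℝ) (M⁻¹.toBlocks₁₁)‖
      ≤ (γ + ν) / ((γ + ν) ^ 2 - lam1 ^ 2 * ν ^ 2) := by
  have hs := aux_mul Sm hdiag
  have hle := aux_le lam1 hlam1_nonneg Sm hdiag hentries
  have ha : 0 < γ + ν := by linarith
  have hl2 : lam1 ^ 2 ≤ 1 := pow_le_one₀ hlam1_nonneg hlam1_le_one
  have hN : (Matrix.fromBlocks (1 : Matrix (Fin dx) (Fin dx) ℝ) (-Sm)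
      (-Sm).conjTranspose (1 : Matrix (Fin dz) (Fin dz) ℝ)).PosSemidef := by
    haveI : Invertible (1 : Matrix (Fin dz) (Fin dz) ℝ) := invertibleOne
    rw [Matrix.PosDef.fromBlocks₂₂ _ _ Matrix.PosDef.one]
    have : (1 : Matrix (Fin dx) (Fin dx) ℝ) - (-Sm) * (1 : Matrix (Fin dz) (Fin dz) ℝ)⁻¹ * (-Sm).conjTranspose
        = Matrix.diagonal (fun i => 1 - ∑ j, Sm i j ^ 2) := by
      simp only [inv_one, Matrix.mul_one, Matrix.conjTranspose_neg, Matrix.conjTranspose_eq_transpose_of_trivial, Matrix.transpose_neg, Matrix.neg_mul, Matrix.mul_neg, neg_neg]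
      rw [hs, ← Matrix.diagonal_one, Matrix.diagonal_sub]
    rw [this]
    refine Matrix.PosSemidef.diagonal ?_
    intro i
    have := hle i
    simp only [Pi.zero_apply]
    linarith
  have hPD : M.PosDef := by
    have : M = γ • (1 : Matrix (Fin dx ⊕ Fin dz) (Fin dx ⊕ Fin dz) ℝ) +
       ν • (Matrix.fromBlocks (1 : Matrix (Fin dx) (Fin dx) ℝ) (-Sm)
      (-Sm).conjTranspose (1 : Matrix (Fin dz) (Fin dz) ℝ)) := by
      rw [hM, ← Matrix.fromBlocks_one, Matrix.fromBlocks_smul, Matrix.fromBlocks_smul,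
        Matrix.fromBlocks_add]
      simp [add_smul]
    rw [this]
    exact (Matrix.PosDef.one.smul hγ).add_posSemidef (hN.smul hν)
  have hU := hPD.isUnit
  have hinv : M⁻¹.toBlocks₁₁ =
      ((γ + ν) • (1 : Matrix (Fin dx) (Fin dx) ℝ) -
        (ν ^ 2 / (γ + ν)) • (Sm * Sm.transpose))⁻¹ := by
    symm
    apply Matrix.inv_eq_right_inv
    have h1 : M * M⁻¹ = 1 := Matrix.mul_nonsing_inv _ ((Matrix.isUnit_iff_isUnit_det _).1 hU)
    rw [← Matrix.fromBlocks_toBlocks M⁻¹, ← Matrix.fromBlocks_one] at h1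
    generalize M⁻¹.toBlocks₁₁ = P at *
    generalize M⁻¹.toBlocks₂₁ = R at *
    rw [hM, Matrix.fromBlocks_multiply, Matrix.fromBlocks_inj] at h1
    obtain ⟨e1, -, e2, -⟩ := h1
    simp only [Matrix.smul_mul, Matrix.one_mul, Matrix.neg_mul] at e1 e2
    have hR : R = (ν / (γ + ν)) • (Sm.transpose * P) := by
      rw [div_eq_inv_mul, mul_smul, neg_add_eq_zero.1 e2, smul_smul, inv_mul_cancel₀ ha.ne', one_smul]
    rw [hR] at e1
    refine Eq.trans ?_ e1
    rw [Matrix.sub_mul, Matrix.smul_mul, Matrix.one_mul, Matrix.smul_mul, Matrix.mul_smul, smul_smul, Matrix.mul_assoc, sub_eq_add_neg,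
      show ν * (ν / (γ + ν)) = ν ^ 2 / (γ + ν) by ring]
  refine ⟨hPD, hU, hinv, ?_⟩
  have hD : 0 < (γ + ν) ^ 2 - lam1 ^ 2 * ν ^ 2 := by nlinarith [sq_nonneg ν, mul_nonneg hγ.le hν]
  have ht : ∀ i, ((γ + ν) ^ 2 - lam1 ^ 2 * ν ^ 2) / (γ + ν) ≤
      (γ + ν) - ν ^ 2 / (γ + ν) * ∑ j, Sm i j ^ 2 := by
    intro i
    have e : (γ + ν) - ν ^ 2 / (γ + ν) * ∑ j, Sm i j ^ 2 =
      ((γ + ν) ^ 2 - (∑ j, Sm i j ^ 2) * ν ^ 2) / (γ + ν) := by field_simp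
    rw [e]
    have := hle i
    gcongr
  have hpos : 0 < ((γ + ν) ^ 2 - lam1 ^ 2 * ν ^ 2) / (γ + ν) := div_pos hD ha
  have hdg : M⁻¹.toBlocks₁₁ = Matrix.diagonal
      (fun i => ((γ + ν) - ν ^ 2 / (γ + ν) * ∑ j, Sm i j ^ 2)⁻¹) := by
    rw [hinv, hs]
    apply Matrix.inv_eq_right_inv
    rw [Matrix.smul_one_eq_diagonal, ← Matrix.diagonal_smul, Matrix.diagonal_sub,
      Matrix.diagonal_mul_diagonal, ← Matrix.diagonal_one]
    congr 1
    ext i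
    exact mul_inv_cancel₀ (hpos.trans_le (ht i)).ne'
  rw [hdg]
  open scoped Matrix.Norms.L2Operator in
  rw [← Matrix.cstar_norm_def, Matrix.l2_opNorm_diagonal]
  rw [pi_norm_le_iff_of_nonneg (by positivity)]
  intro i
  rw [Real.norm_of_nonneg (inv_nonneg.2 (hpos.le.trans (ht i))), ← inv_div ((γ + ν) ^ 2 - lam1 ^ 2 * ν ^ 2)]
  exact inv_anti₀ hpos (ht i)
end

section
/- Let Ω ⊆ ℝ^d be convex, H : ℝ^d → ℝ, n ≥ 1, σ > 0, and let h, h′ : ℝ^d → ℝ be nonnegative, convex, differentiable and β-smooth. Assume that both F = H + h/n and F′ = H + h′/n are σ-strongly convex on Ω, and let u minimize F over Ω and u′ minimize F′ over Ω. Then (h(u′) − h(u)) + (h′(u) − h′(u′)) ≤ (8β/(σn))·(h(u′) + h′(u)). -/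
open scoped RealInnerProductSpace

theorem aux_line {d : ℕ} (f : EuclideanSpace ℝ (Fin d) → ℝ) (x v : EuclideanSpace ℝ (Fin d))
    (hf : DifferentiableAt ℝ f x) :
    HasDerivAt (fun t : ℝ => f (x + t • v)) (⟪gradient f x, v⟫) 0 := by
  have h1 : HasFDerivAt f (InnerProductSpace.toDual ℝ _ (gradient f x)) (x + (0:ℝ) • v) := by
    simpa using hf.hasGradientAt.hasFDerivAt
  have h2 : HasDerivAt (fun t : ℝ => x + t • v) v 0 := by
    simpa using ((hasDerivAt_id (0:ℝ)).smul_const v).const_add x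
  exact h1.comp_hasDerivAt (0:ℝ) h2

theorem aux_lower (φ : ℝ → ℝ) (D c : ℝ) (h : HasDerivAt φ D 0)
    (hc : ∀ t : ℝ, 0 < t → t ≤ 1 → φ 0 + t * c ≤ φ t) : c ≤ D := by
  have h1 := h.tendsto_slope_zero_right
  refine ge_of_tendsto h1 ?_
  filter_upwards [Ioc_mem_nhdsGT (zero_lt_one : (0:ℝ) < 1)] with t ht
  have := hc t ht.1 ht.2
  simp only [zero_add, smul_eq_mul]
  rw [← div_eq_inv_mul, le_div_iff₀ ht.1]
  linarith

theorem aux_opt {d : ℕ} (F : EuclideanSpace ℝ (Fin d) → ℝ) (S : Set (EuclideanSpace ℝ (Fin d)))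
    (hS : Convex ℝ S) (u w : EuclideanSpace ℝ (Fin d)) (hu : u ∈ S) (hw : w ∈ S)
    (hmin : ∀ w ∈ S, F u ≤ F w) : 0 ≤ ⟪gradient F u, w - u⟫ := by
  by_cases hd : DifferentiableAt ℝ F u
  · refine aux_lower _ _ 0 (aux_line F u (w - u) hd) ?_
    intro t ht ht1
    simpa using hmin _ (hS.add_smul_sub_mem hu hw ⟨ht.le, ht1⟩)
  · simp [gradient_eq_zero_of_not_differentiableAt hd]

theorem aux_conv {d : ℕ} (f : EuclideanSpace ℝ (Fin d) → ℝ) (hf : ConvexOn ℝ Set.univ f)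
    (hd : Differentiable ℝ f) (x y : EuclideanSpace ℝ (Fin d)) :
    ⟪gradient f x, y - x⟫ ≤ f y - f x := by
  have := aux_lower _ _ (-(f y - f x)) (aux_line f x (y - x) (hd x)).neg ?_
  · linarith
  intro t ht ht1
  have h2 := hf.2 (Set.mem_univ x) (Set.mem_univ y) (sub_nonneg.2 ht1) ht.le (by ring)
  have e : x + t • (y - x) = (1 - t) • x + t • y := by module
  simp only [Pi.neg_apply, zero_smul, add_zero, e]
  simp only [smul_eq_mul] at h2
  linarith

theorem aux_half {d : ℕ} (f : EuclideanSpace ℝ (Fin d) → ℝ) (hf : ConvexOn ℝ Set.univ f)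
    (hd : Differentiable ℝ f) (h0 : ∀ w, 0 ≤ f w) (β : ℝ)
    (hs : ∀ w₁ w₂, f w₁ ≤ f w₂ + ⟪gradient f w₂, w₁ - w₂⟫ + β / 2 * ‖w₁ - w₂‖ ^ 2)
    (x y : EuclideanSpace ℝ (Fin d)) (t : ℝ) (ht : 0 ≤ t) :
    t * (f x - f y) ≤ f x + β / 2 * (t ^ 2 * ‖y - x‖ ^ 2) := by
  have h1 := hs (x + t • (y - x)) x
  have h2 := h0 (x + t • (y - x))
  rw [add_sub_cancel_left, inner_smul_right, norm_smul, mul_pow, Real.norm_eq_abs, sq_abs] at h1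
  have h3 := mul_le_mul_of_nonneg_left (aux_conv f hf hd x y) ht
  linarith

theorem stmt18
    {d : ℕ} (n : ℕ) (hn : 1 ≤ n) (σ β : ℝ) (hσ : 0 < σ) (hβ : 0 < β)
    (Ωs : Set (EuclideanSpace ℝ (Fin d))) (hΩs : Convex ℝ Ωs)
    (H h h' : EuclideanSpace ℝ (Fin d) → ℝ)
    (hh_nonneg : ∀ w, 0 ≤ h w) (hh'_nonneg : ∀ w, 0 ≤ h' w)
    (hh_convex : ConvexOn ℝ Set.univ h) (hh'_convex : ConvexOn ℝ Set.univ h')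
    (hh_diff : Differentiable ℝ h) (hh'_diff : Differentiable ℝ h')
    (hh_smooth : ∀ w₁ w₂,
      h w₁ ≤ h w₂ + ⟪gradient h w₂, w₁ - w₂⟫ + β / 2 * ‖w₁ - w₂‖ ^ 2)
    (hh'_smooth : ∀ w₁ w₂,
      h' w₁ ≤ h' w₂ + ⟪gradient h' w₂, w₁ - w₂⟫ + β / 2 * ‖w₁ - w₂‖ ^ 2)
    (F F' : EuclideanSpace ℝ (Fin d) → ℝ)
    (hF : F = fun w => H w + h w / n) (hF' : F' = fun w => H w + h' w / n)
    (hF_strconv : ∀ w₁ ∈ Ωs, ∀ w₂ ∈ Ωs,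
      F w₂ + ⟪gradient F w₂, w₁ - w₂⟫ + σ / 2 * ‖w₁ - w₂‖ ^ 2 ≤ F w₁)
    (hF'_strconv : ∀ w₁ ∈ Ωs, ∀ w₂ ∈ Ωs,
      F' w₂ + ⟪gradient F' w₂, w₁ - w₂⟫ + σ / 2 * ‖w₁ - w₂‖ ^ 2 ≤ F' w₁)
    (u u' : EuclideanSpace ℝ (Fin d)) (hu_mem : u ∈ Ωs) (hu'_mem : u' ∈ Ωs)
    (hu_min : ∀ w ∈ Ωs, F u ≤ F w) (hu'_min : ∀ w ∈ Ωs, F' u' ≤ F' w) :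
    (h u' - h u) + (h' u - h' u') ≤ 8 * β / (σ * n) * (h u' + h' u) := by
  have hn0 : (0:ℝ) < n := by exact_mod_cast hn
  have a1 := hF_strconv u' hu'_mem u hu_mem
  have a2 := aux_opt F Ωs hΩs u u' hu_mem hu'_mem hu_min
  have b1 := hF'_strconv u hu_mem u' hu'_mem
  have b2 := aux_opt F' Ωs hΩs u' u hu'_mem hu_mem hu'_min
  set t : ℝ := n * σ / (2 * β) with ht
  have ht0 : 0 ≤ t := by positivity
  have c1 := aux_half h hh_convex hh_diff hh_nonneg β hh_smooth u' u t ht0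
  have c2 := aux_half h' hh'_convex hh'_diff hh'_nonneg β hh'_smooth u u' t ht0
  rw [norm_sub_rev u' u] at a1 c2
  generalize ‖u - u'‖ ^ 2 = r at *
  have key : σ * r ≤ ((h u' - h u) + (h' u - h' u')) / n := by
    have e : ((h u' - h u) + (h' u - h' u')) / n = F u' - F u + (F' u - F' u') := by
      rw [hF, hF']; ring
    rw [e]; linarith
  rw [le_div_iff₀ hn0] at key
  have p1 := hh_nonneg u'
  have p2 := hh'_nonneg u
  have c3 : t * ((h u' - h u) + (h' u - h' u')) ≤ h u' + h' u + β * t ^ 2 * r := by linarith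
  generalize (h u' - h u) + (h' u - h' u') = Δ at *
  have c4 : β * t ^ 2 * r ≤ t / 2 * Δ := by
    have e : β * t ^ 2 * r = t / 2 * (σ * r * n) := by rw [ht]; field_simp
    rw [e]
    exact mul_le_mul_of_nonneg_left key (by positivity)
  have c5 : n * σ * Δ ≤ 4 * β * (h u' + h' u) := by
    have e : n * σ * Δ = 4 * β * (t / 2 * Δ) := by rw [ht]; field_simp; ring
    rw [e]
    exact mul_le_mul_of_nonneg_left (by linarith) (by positivity)
  have p3 : 0 ≤ β * (h u' + h' u) := by positivity
  rw [div_mul_eq_mul_div, le_div_iff₀ (by positivity)]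
  linarith
end
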